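/- arXiv:1606.00149 — 4 statements merged into one kernel-verified Lean document; each statement's English description precedes it below -/
import Mathlib

section
/- Let m be a natural number, z, c complex numbers, σ ∈ {0,1}, and let a : ℕ → ℂ be a sequence satisfying, for all k ≥ 2, (k+σ)(k+σ−1)·a_k = ((k−1+2m+σ)(k−2+σ) − z)·a_{k−2} + c²·a_{k−4}, where a_{k−4} is interpreted as 0 when k < 4. Then for every ε > 0 there exists a constant C > 0 such that |a_k| ≤ C·(1+ε)^k for all k ∈ ℕ; consequently the power series Σ_k a_k η^k converges absolutely for every complex η with |η| < 1. -/
/-- A sequence which eventually satisfies a two-step recurrence inequality with weights summing to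
at most `r ^ 2` grows at most like `r ^ k`. -/
theorem exists_norm_le_mul_pow_of_recurrence (a : ℕ → ℂ) {r : ℝ} (hr : 1 ≤ r) (N : ℕ)
    (h : ∀ k, N ≤ k → ∃ p q d : ℝ, 0 ≤ p ∧ 0 ≤ q ∧ 0 < d ∧ p + q ≤ d * r ^ 2 ∧
      d * ‖a (k + 4)‖ ≤ p * ‖a (k + 2)‖ + q * ‖a k‖) :
    ∃ C : ℝ, 0 < C ∧ ∀ k, ‖a k‖ ≤ C * r ^ k := by
  have hr0 : 0 < r := by linarith
  have hS : 0 ≤ ∑ i ∈ Finset.range (N + 4), ‖a i‖ := Finset.sum_nonneg fun _ _ => norm_nonneg _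
  refine ⟨∑ i ∈ Finset.range (N + 4), ‖a i‖ + 1, by linarith, fun k => ?_⟩
  set C := ∑ i ∈ Finset.range (N + 4), ‖a i‖ + 1 with hC
  have hC0 : 0 < C := by linarith
  induction k using Nat.strong_induction_on with
  | _ k ih =>
    rcases lt_or_ge k (N + 4) with hk | hk
    · have h1 : ‖a k‖ ≤ ∑ i ∈ Finset.range (N + 4), ‖a i‖ :=
        Finset.single_le_sum (f := fun i => ‖a i‖) (fun _ _ => norm_nonneg _)
          (Finset.mem_range.2 hk)
      calc ‖a k‖ ≤ C := by linarith
        _ ≤ C * r ^ k := le_mul_of_one_le_right hC0.le (one_le_pow₀ hr)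
    · obtain ⟨j, rfl⟩ : ∃ j, k = j + 4 := ⟨k - 4, by omega⟩
      obtain ⟨p, q, d, hp, hq, hd, hpq, hle⟩ := h j (by omega)
      have h2 := ih (j + 2) (by omega)
      have h0 : ‖a j‖ ≤ C * r ^ (j + 2) := (ih j (by omega)).trans <|
        mul_le_mul_of_nonneg_left (pow_le_pow_right₀ hr (by omega)) hC0.le
      refine le_of_mul_le_mul_left ?_ hd
      calc d * ‖a (j + 4)‖ ≤ p * ‖a (j + 2)‖ + q * ‖a j‖ := hle
        _ ≤ p * (C * r ^ (j + 2)) + q * (C * r ^ (j + 2)) := by gcongr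
        _ = (p + q) * (C * r ^ (j + 2)) := by ring
        _ ≤ d * r ^ 2 * (C * r ^ (j + 2)) := by gcongr
        _ = d * (C * r ^ (j + 4)) := by ring

/-- A sequence growing slower than every `(1 + ε) ^ k` has a power series which converges
absolutely on the open unit disc. -/
theorem summable_norm_mul_pow_of_subexponential (a : ℕ → ℂ)
    (h : ∀ ε : ℝ, 0 < ε → ∃ C : ℝ, 0 < C ∧ ∀ k : ℕ, ‖a k‖ ≤ C * (1 + ε) ^ k)
    {η : ℂ} (hη : ‖η‖ < 1) : Summable fun k : ℕ => ‖a k * η ^ k‖ := by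
  have hη0 := norm_nonneg η
  obtain ⟨C, -, hC⟩ := h ((1 - ‖η‖) / 2) (by linarith)
  have hgeom : Summable fun k : ℕ => C * ((1 + (1 - ‖η‖) / 2) * ‖η‖) ^ k :=
    (summable_geometric_of_lt_one (mul_nonneg (by linarith) hη0) (by nlinarith)).mul_left C
  refine hgeom.of_nonneg_of_le (fun _ => norm_nonneg _) fun k => ?_
  rw [norm_mul, norm_pow, mul_pow, ← mul_assoc]
  exact mul_le_mul_of_nonneg_right (hC k) (pow_nonneg hη0 k)


/-- Perron–Kreuser bound about the ordinary point: any solution of the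
coefficient recurrence `(k+σ)(k+σ-1)·aₖ = ((k-1+2m+σ)(k-2+σ) - z)·a_{k-2} + c²·a_{k-4}`
grows slower than `(1+ε)^k` for every `ε > 0`, so `Σ aₖ ηᵏ` converges absolutely for
`|η| < 1`. -/
theorem perron_kreuser_ordinary_point
    (m : ℕ) (z c : ℂ) (σ : ℕ) (hσ : σ = 0 ∨ σ = 1) (a : ℕ → ℂ)
    (hrec : ∀ k : ℕ, 2 ≤ k →
      ((k : ℂ) + (σ : ℂ)) * ((k : ℂ) + (σ : ℂ) - 1) * a k =
        (((k : ℂ) - 1 + 2 * (m : ℂ) + (σ : ℂ)) * ((k : ℂ) - 2 + (σ : ℂ)) - z) * a (k - 2)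
          + c ^ 2 * (if k < 4 then 0 else a (k - 4))) :
    (∀ ε : ℝ, 0 < ε → ∃ C : ℝ, 0 < C ∧ ∀ k : ℕ, ‖a k‖ ≤ C * (1 + ε) ^ k) ∧
    (∀ η : ℂ, ‖η‖ < 1 → Summable fun k : ℕ => ‖a k * η ^ k‖) := by
  suffices H : ∀ ε : ℝ, 0 < ε → ∃ C : ℝ, 0 < C ∧ ∀ k : ℕ, ‖a k‖ ≤ C * (1 + ε) ^ k from
    ⟨H, fun _ hη => summable_norm_mul_pow_of_subexponential a H hη⟩
  intro ε hε
  obtain ⟨N, hN⟩ := exists_nat_ge ((2 * m + ‖z‖ + ‖c‖ ^ 2) / (2 * ε))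
  rw [div_le_iff₀ (by positivity)] at hN
  refine exists_norm_le_mul_pow_of_recurrence a (by linarith) N fun k hk => ?_
  have hkN : (N : ℝ) ≤ k := by exact_mod_cast hk
  have hk0 : (0 : ℝ) ≤ k := k.cast_nonneg
  have hs0 : (0 : ℝ) ≤ σ := σ.cast_nonneg
  have hm0 : (0 : ℝ) ≤ m := m.cast_nonneg
  obtain ⟨n, hn⟩ : ∃ n : ℝ, n = k + σ := ⟨_, rfl⟩
  have hn0 : 0 ≤ n := by linarith
  refine ⟨(n + 3 + 2 * m) * (n + 2) + ‖z‖, ‖c‖ ^ 2, (n + 4) * (n + 3), by positivity,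
    by positivity, by positivity, ?_, ?_⟩
  · have h1 : 2 * m + ‖z‖ + ‖c‖ ^ 2 ≤ (n + 4) * (2 * ε) :=
      hN.trans (mul_le_mul_of_nonneg_right (by linarith) (by positivity))
    have h2 := mul_le_mul_of_nonneg_left h1 (show 0 ≤ n + 3 by linarith)
    have h3 : 0 ≤ (n + 4) * (n + 3) * ε ^ 2 := by positivity
    have h4 : 0 ≤ (n + 2) * (‖z‖ + ‖c‖ ^ 2) := by positivity
    linarith
  · have e := hrec (k + 4) (by omega)
    rw [if_neg (by omega), show k + 4 - 2 = k + 2 by omega, Nat.add_sub_cancel] at e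
    have e' : (((n + 4) * (n + 3) : ℝ) : ℂ) * a (k + 4) =
        ((((n + 3 + 2 * m) * (n + 2) : ℝ) : ℂ) - z) * a (k + 2) + c ^ 2 * a k := by
      rw [hn]
      push_cast at e ⊢
      linear_combination e
    have hd : ‖(((n + 4) * (n + 3) : ℝ) : ℂ)‖ = (n + 4) * (n + 3) :=
      Complex.norm_of_nonneg (by positivity)
    have hp : ‖(((n + 3 + 2 * m) * (n + 2) : ℝ) : ℂ)‖ = (n + 3 + 2 * m) * (n + 2) :=
      Complex.norm_of_nonneg (by positivity)
    calc (n + 4) * (n + 3) * ‖a (k + 4)‖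
        = ‖((((n + 3 + 2 * m) * (n + 2) : ℝ) : ℂ) - z) * a (k + 2) + c ^ 2 * a k‖ := by
          rw [← e', norm_mul, hd]
      _ ≤ ‖(((n + 3 + 2 * m) * (n + 2) : ℝ) : ℂ) - z‖ * ‖a (k + 2)‖ + ‖c‖ ^ 2 * ‖a k‖ := by
          refine (norm_add_le _ _).trans_eq ?_
          rw [norm_mul, norm_mul, norm_pow]
      _ ≤ ((n + 3 + 2 * m) * (n + 2) + ‖z‖) * ‖a (k + 2)‖ + ‖c‖ ^ 2 * ‖a k‖ := by
          gcongr
          exact (norm_sub_le _ _).trans_eq (by rw [hp])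
end

section
/- Let m be a natural number, z, c complex numbers, and let b : ℕ → ℂ satisfy, for all j ≥ 1, 2j(j+m)·b_j = ((j−1)(j+2m) − z + c²)·b_{j−1} − 2c²·b_{j−2} + c²·b_{j−3}, where b_{j−2} and b_{j−3} are interpreted as 0 when the index would be negative. Then for every ε > 0 there exists a constant C > 0 such that |b_j| ≤ C·(1/2 + ε)^j for all j ∈ ℕ; consequently the power series Σ_j b_j t^j converges absolutely for every complex t with |t| < 2. -/
/-- A sequence that satisfies the geometric bound `C * r ^ n` at `n + 3` whenever it satisfies it
at the three previous indices, for `n` large and every `C ≥ 0`, is bounded geometrically. -/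
lemma exists_geometric_bound_of_step {a : ℕ → ℝ} (ha : ∀ n, 0 ≤ a n) {r : ℝ} (hr : 0 < r)
    {N : ℕ} (hstep : ∀ n, N ≤ n → ∀ C : ℝ, 0 ≤ C → a n ≤ C * r ^ n →
      a (n + 1) ≤ C * r ^ (n + 1) → a (n + 2) ≤ C * r ^ (n + 2) →
      a (n + 3) ≤ C * r ^ (n + 3)) :
    ∃ C : ℝ, 0 < C ∧ ∀ n, a n ≤ C * r ^ n := by
  have hnonneg : ∀ i, 0 ≤ a i / r ^ i := fun i => div_nonneg (ha i) (by positivity)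
  set C := 1 + ∑ i ∈ Finset.range (N + 3), a i / r ^ i with hC
  have hC0 : 0 < C := by
    have := Finset.sum_nonneg fun i (_ : i ∈ Finset.range (N + 3)) => hnonneg i
    linarith
  refine ⟨C, hC0, fun n => ?_⟩
  induction n using Nat.strong_induction_on with
  | _ n ih =>
    rcases lt_or_ge n (N + 3) with hn | hn
    · rw [← div_le_iff₀ (by positivity)]
      have := Finset.single_le_sum (fun i _ => hnonneg i) (Finset.mem_range.2 hn)
      linarith
    · obtain ⟨k, rfl⟩ : ∃ k, n = k + 3 := ⟨n - 3, by omega⟩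
      exact hstep k (by omega) C hC0.le (ih _ (by omega)) (ih _ (by omega)) (ih _ (by omega))

/-- The recurrence of the regular solution, as an inequality between norms. -/
lemma norm_recurrence_le {m : ℕ} {z c w w₁ w₂ w₃ : ℂ} {j : ℕ} (hj : 1 ≤ j)
    (h : 2 * (j : ℂ) * ((j : ℂ) + (m : ℂ)) * w =
      (((j : ℂ) - 1) * ((j : ℂ) + 2 * (m : ℂ)) - z + c ^ 2) * w₁ - 2 * c ^ 2 * w₂ + c ^ 2 * w₃) :
    2 * ((j : ℝ) * (j + m)) * ‖w‖ ≤
      ((j : ℝ) * (j + m) + m * j + (‖z‖ + ‖c‖ ^ 2)) * ‖w₁‖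
        + 2 * (‖z‖ + ‖c‖ ^ 2) * ‖w₂‖ + (‖z‖ + ‖c‖ ^ 2) * ‖w₃‖ := by
  have hj' : (1 : ℝ) ≤ j := by exact_mod_cast hj
  have hlhs : ‖2 * (j : ℂ) * ((j : ℂ) + (m : ℂ)) * w‖ = 2 * ((j : ℝ) * (j + m)) * ‖w‖ := by
    have : 2 * (j : ℂ) * ((j : ℂ) + (m : ℂ)) = ((2 * ((j : ℝ) * (j + m)) : ℝ) : ℂ) := by
      push_cast; ring
    rw [this, norm_mul, Complex.norm_real, Real.norm_of_nonneg (by positivity)]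
  have hmain : ‖((j : ℂ) - 1) * ((j : ℂ) + 2 * (m : ℂ))‖ ≤ (j : ℝ) * (j + m) + m * j := by
    have : ((j : ℂ) - 1) * ((j : ℂ) + 2 * (m : ℂ)) =
        ((((j : ℝ) - 1) * (j + 2 * m) : ℝ) : ℂ) := by
      push_cast; ring
    rw [this, Complex.norm_real,
      Real.norm_of_nonneg (mul_nonneg (by linarith) (by positivity))]
    have : (0 : ℝ) ≤ m := m.cast_nonneg
    nlinarith
  have hcoeff : ‖((j : ℂ) - 1) * ((j : ℂ) + 2 * (m : ℂ)) - z + c ^ 2‖ ≤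
      (j : ℝ) * (j + m) + m * j + (‖z‖ + ‖c‖ ^ 2) := by
    have h₁ := norm_add_le (((j : ℂ) - 1) * ((j : ℂ) + 2 * (m : ℂ)) - z) (c ^ 2)
    have h₂ := norm_sub_le (((j : ℂ) - 1) * ((j : ℂ) + 2 * (m : ℂ))) z
    rw [norm_pow] at h₁
    linarith
  have hc : ‖c‖ ^ 2 ≤ ‖z‖ + ‖c‖ ^ 2 := by linarith [norm_nonneg z]
  rw [← hlhs, h]
  refine (norm_add_le _ _).trans (add_le_add ((norm_sub_le _ _).trans (add_le_add ?_ ?_)) ?_)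
  · rw [norm_mul]; gcongr
  · rw [norm_mul, norm_mul, norm_pow, Complex.norm_ofNat]; gcongr
  · rw [norm_mul, norm_pow]; gcongr

/-- Perron–Kreuser bound about the regular singular point: any solution of
the recurrence `2j(j+m)·bⱼ = ((j-1)(j+2m) - z + c²)·b_{j-1} - 2c²·b_{j-2} + c²·b_{j-3}`
grows slower than `(1/2 + ε)^j` for every `ε > 0`, so `Σ bⱼ tʲ` converges absolutely for
`|t| < 2`. -/
theorem perron_kreuser_regular_point
    (m : ℕ) (z c : ℂ) (b : ℕ → ℂ)
    (hrec : ∀ j : ℕ, 1 ≤ j →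
      2 * (j : ℂ) * ((j : ℂ) + (m : ℂ)) * b j =
        (((j : ℂ) - 1) * ((j : ℂ) + 2 * (m : ℂ)) - z + c ^ 2) * b (j - 1)
          - 2 * c ^ 2 * (if j < 2 then 0 else b (j - 2))
          + c ^ 2 * (if j < 3 then 0 else b (j - 3))) :
    (∀ ε : ℝ, 0 < ε → ∃ C : ℝ, 0 < C ∧ ∀ j : ℕ, ‖b j‖ ≤ C * (1 / 2 + ε) ^ j) ∧
    (∀ t : ℂ, ‖t‖ < 2 → Summable fun j : ℕ => ‖b j * t ^ j‖) := by
  have hbound : ∀ ε : ℝ, 0 < ε → ∃ C : ℝ, 0 < C ∧ ∀ j : ℕ, ‖b j‖ ≤ C * (1 / 2 + ε) ^ j := by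
    intro ε hε
    obtain ⟨r, hr⟩ : ∃ r : ℝ, r = 1 / 2 + ε := ⟨_, rfl⟩
    obtain ⟨K, hK⟩ : ∃ K : ℝ, K = ‖z‖ + ‖c‖ ^ 2 := ⟨_, rfl⟩
    have hr0 : 0 < r := by linarith
    have hK0 : 0 ≤ K := hK ▸ by positivity
    rw [← hr]
    obtain ⟨N, hN⟩ := exists_nat_ge (((m + K) * r ^ 2 + 2 * K * r + K) / (2 * ε * r ^ 2))
    rw [div_le_iff₀ (by positivity)] at hN
    refine exists_geometric_bound_of_step (fun n => norm_nonneg (b n)) hr0 (N := N) ?_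
    intro n hn C hC h₀ h₁ h₂
    have hrec' := hrec (n + 3) (by omega)
    rw [if_neg (by omega), if_neg (by omega)] at hrec'
    have hle := norm_recurrence_le (by omega) hrec'
    rw [← hK] at hle
    simp only [show n + 3 - 1 = n + 2 by omega, show n + 3 - 2 = n + 1 by omega,
      show n + 3 - 3 = n by omega] at hle
    obtain ⟨x, hx⟩ : ∃ x : ℝ, x = ((n + 3 : ℕ) : ℝ) := ⟨_, rfl⟩
    have hx1 : 1 ≤ x := by rw [hx]; exact_mod_cast (by omega : 1 ≤ n + 3)
    have hNx : (N : ℝ) ≤ x := by rw [hx]; exact_mod_cast (by omega : N ≤ n + 3)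
    have hm : (0 : ℝ) ≤ m := m.cast_nonneg
    rw [← hx] at hle
    have hcoeff : (x * (x + m) + m * x + K) * r ^ 2 + 2 * K * r + K ≤
        2 * (x * (x + m)) * r ^ 3 := by
      have hsmall : (m * x + K) * r ^ 2 + 2 * K * r + K ≤ 2 * ε * r ^ 2 * (x * (x + m)) :=
        calc (m * x + K) * r ^ 2 + 2 * K * r + K
            ≤ (m * x + K * x) * r ^ 2 + 2 * (K * x) * r + K * x := by
              gcongr <;> exact le_mul_of_one_le_right hK0 hx1
          _ = x * ((m + K) * r ^ 2 + 2 * K * r + K) := by ring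
          _ ≤ x * (x * (2 * ε * r ^ 2)) := by
              gcongr
              exact hN.trans (by gcongr)
          _ = 2 * ε * r ^ 2 * (x * x) := by ring
          _ ≤ 2 * ε * r ^ 2 * (x * (x + m)) := by
              gcongr
              linarith
      have hpow : 2 * (x * (x + m)) * r ^ 3 =
          x * (x + m) * r ^ 2 + 2 * ε * r ^ 2 * (x * (x + m)) := by
        rw [pow_succ r 2]
        nth_rewrite 2 [hr]
        ring
      linarith
    refine le_of_mul_le_mul_left (hle.trans ?_) (by positivity : 0 < 2 * (x * (x + m)))
    calc (x * (x + m) + m * x + K) * ‖b (n + 2)‖ + 2 * K * ‖b (n + 1)‖ + K * ‖b n‖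
        ≤ (x * (x + m) + m * x + K) * (C * r ^ (n + 2)) + 2 * K * (C * r ^ (n + 1))
          + K * (C * r ^ n) := by gcongr
      _ = C * r ^ n * ((x * (x + m) + m * x + K) * r ^ 2 + 2 * K * r + K) := by ring
      _ ≤ C * r ^ n * (2 * (x * (x + m)) * r ^ 3) := by gcongr
      _ = 2 * (x * (x + m)) * (C * r ^ (n + 3)) := by ring
  refine ⟨hbound, fun t ht => ?_⟩
  obtain ⟨C, -, hC⟩ := hbound ((2 - ‖t‖) / 8) (by linarith)
  have ht0 := norm_nonneg t
  have hgeom : Summable fun j : ℕ => C * ((1 / 2 + (2 - ‖t‖) / 8) * ‖t‖) ^ j :=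
    (summable_geometric_of_lt_one (mul_nonneg (by linarith) ht0) (by nlinarith)).mul_left C
  refine hgeom.of_nonneg_of_le (fun j => norm_nonneg _) fun j => ?_
  rw [norm_mul, norm_pow, mul_pow, ← mul_assoc]
  exact mul_le_mul_of_nonneg_right (hC j) (by positivity)
end

section
/- Let m be a natural number and b : ℕ → ℂ a sequence such that Σ_j |b_j|·ρ^j < ∞ for some real ρ > 2. Then ∫_{−1}^{1} (1−η²)^m·|Σ_{j≥0} b_j·(1−η)^j|² dη = Σ_{k=0}^{m} (−1)^k·C(m,k)·Σ_{l≥0} 2^{2m+l+1}·(Σ_{j=0}^{l} b_j·conj(b_{l−j}))/(l+m+k+1), where the series over l converges absolutely and conj denotes complex conjugation. -/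
/-- If `∑ ‖bⱼ‖ ρ ^ j` converges then `∑ bⱼ z ^ j` converges absolutely on `‖z‖ ≤ ρ`. -/
theorem summable_norm_mul_pow_of_le {b : ℕ → ℂ} {ρ : ℝ}
    (hb : Summable fun j : ℕ => ‖b j‖ * ρ ^ j) {z : ℂ} (hz : ‖z‖ ≤ ρ) :
    Summable fun j : ℕ => ‖b j * z ^ j‖ := by
  refine hb.of_nonneg_of_le (fun j => norm_nonneg _) fun j => ?_
  rw [norm_mul, norm_pow]
  gcongr

theorem sum_range_mul_pow_mul_conj (b : ℕ → ℂ) (x : ℝ) (l : ℕ) :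
    ∑ j ∈ Finset.range (l + 1),
        (b j * (x : ℂ) ^ j) * starRingEnd ℂ (b (l - j) * (x : ℂ) ^ (l - j)) =
      (∑ j ∈ Finset.range (l + 1), b j * starRingEnd ℂ (b (l - j))) * (x : ℂ) ^ l := by
  rw [Finset.sum_mul]
  refine Finset.sum_congr rfl fun j hj => ?_
  have hjl : j + (l - j) = l := by
    have := Finset.mem_range.mp hj
    omega
  have hx : (x : ℂ) ^ l = (x : ℂ) ^ j * (x : ℂ) ^ (l - j) := by rw [← pow_add, hjl]
  rw [map_mul, map_pow, Complex.conj_ofReal, hx]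
  ring

/-- The squared modulus of a power series at a real point is the power series whose coefficients
are the Cauchy product of the coefficients with their conjugates. -/
theorem summable_norm_and_hasSum_norm_sq {b : ℕ → ℂ} {x : ℝ}
    (h : Summable fun j : ℕ => ‖b j * (x : ℂ) ^ j‖) :
    (Summable fun l : ℕ =>
      ‖(∑ j ∈ Finset.range (l + 1), b j * starRingEnd ℂ (b (l - j))) * (x : ℂ) ^ l‖) ∧
    HasSum (fun l : ℕ =>
        (∑ j ∈ Finset.range (l + 1), b j * starRingEnd ℂ (b (l - j))) * (x : ℂ) ^ l)
      (((‖∑' j : ℕ, b j * (x : ℂ) ^ j‖ ^ 2 : ℝ)) : ℂ) := by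
  have h' : Summable fun j : ℕ => ‖starRingEnd ℂ (b j * (x : ℂ) ^ j)‖ := by
    simpa only [RCLike.norm_conj] using h
  have hs := summable_norm_sum_mul_range_of_summable_norm h h'
  have ht := tsum_mul_tsum_eq_tsum_sum_range_of_summable_norm h h'
  simp only [sum_range_mul_pow_mul_conj] at hs ht
  refine ⟨hs, ?_⟩
  rw [← Complex.conj_tsum, Complex.mul_conj, Complex.normSq_eq_norm_sq] at ht
  rw [ht]
  exact hs.of_norm.hasSum

theorem integral_pow_mul_two_sub_pow_mul_pow (m l : ℕ) (c : ℂ) :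
    ∫ x in (0 : ℝ)..2, (x : ℂ) ^ m * (2 - (x : ℂ)) ^ m * (c * (x : ℂ) ^ l) =
      ∑ k ∈ Finset.range (m + 1), (-1 : ℂ) ^ k * (m.choose k : ℂ) *
        ((2 : ℂ) ^ (2 * m + l + 1) * c / ((l : ℂ) + (m : ℂ) + (k : ℂ) + 1)) := by
  have hexp : ∀ x : ℝ, (x : ℂ) ^ m * (2 - (x : ℂ)) ^ m * (c * (x : ℂ) ^ l) =
      ∑ k ∈ Finset.range (m + 1), ((-1 : ℂ) ^ k * (m.choose k : ℂ) * 2 ^ (m - k) * c) *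
        ((x ^ (l + m + k) : ℝ) : ℂ) := by
    intro x
    rw [sub_eq_neg_add, add_pow, Finset.mul_sum, Finset.sum_mul]
    refine Finset.sum_congr rfl fun k _ => ?_
    rw [neg_pow]
    push_cast
    ring
  simp only [hexp]
  rw [intervalIntegral.integral_finsetSum fun k _ =>
    Continuous.intervalIntegrable (by fun_prop) _ _]
  refine Finset.sum_congr rfl fun k hk => ?_
  have hkm : 2 * m + l + 1 = (m - k) + (l + m + k + 1) := by
    have := Finset.mem_range.mp hk
    omega
  rw [intervalIntegral.integral_const_mul, intervalIntegral.integral_ofReal, integral_pow, hkm,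
    pow_add (2 : ℂ) (m - k)]
  push_cast
  rw [zero_pow (Nat.succ_ne_zero _)]
  ring

/-- Termwise integration of a power series against `x ^ m * (2 - x) ^ m` on `[0, 2]`. -/
theorem hasSum_integral_pow_mul_two_sub_pow (m : ℕ) {c : ℕ → ℂ} {G : ℝ → ℂ}
    (hc : Summable fun l : ℕ => ‖c l * (2 : ℂ) ^ l‖)
    (hG : ∀ x ∈ Set.Icc (0 : ℝ) 2, HasSum (fun l : ℕ => c l * (x : ℂ) ^ l) (G x)) :
    HasSum (fun l : ℕ => ∫ x in (0 : ℝ)..2,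
        (x : ℂ) ^ m * (2 - (x : ℂ)) ^ m * (c l * (x : ℂ) ^ l))
      (∫ x in (0 : ℝ)..2, (x : ℂ) ^ m * (2 - (x : ℂ)) ^ m * G x) := by
  have hmem : ∀ x ∈ Set.uIoc (0 : ℝ) 2, x ∈ Set.Icc (0 : ℝ) 2 := fun x hx => by
    rw [Set.uIoc_of_le zero_le_two] at hx
    exact Set.Ioc_subset_Icc_self hx
  refine intervalIntegral.hasSum_integral_of_dominated_convergence
    (fun l _ => 2 ^ m * 2 ^ m * ‖c l * (2 : ℂ) ^ l‖)
    (fun l => Continuous.aestronglyMeasurable (by fun_prop)) (fun l => ?_)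
    (.of_forall fun x _ => hc.mul_left _) intervalIntegrable_const
    (.of_forall fun x hx => (hG x (hmem x hx)).mul_left _)
  refine .of_forall fun x hx => ?_
  obtain ⟨h0, h2⟩ := hmem x hx
  have hx1 : ‖(x : ℂ)‖ ≤ 2 := by rwa [Complex.norm_of_nonneg h0]
  have hx2 : ‖2 - (x : ℂ)‖ ≤ 2 := by
    have : 2 - (x : ℂ) = ((2 - x : ℝ) : ℂ) := by push_cast; rfl
    rw [this, Complex.norm_of_nonneg (by linarith)]
    linarith
  simp only [norm_mul, norm_pow, Complex.norm_ofNat]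
  gcongr


/-- algebraic integration of the squared modulus of an angular spheroidal
wave function: `∫_{-1}^1 (1-η²)^m |Σⱼ bⱼ(1-η)^j|² dη` equals the double series
`Σ_{k=0}^m (-1)^k C(m,k) Σ_l 2^{2m+l+1} (Σ_{j=0}^l bⱼ · conj(b_{l-j}))/(l+m+k+1)`,
the series over `l` converging absolutely. -/
theorem normalization_integral_eval
    (m : ℕ) (b : ℕ → ℂ) (ρ : ℝ) (hρ : 2 < ρ)
    (hb : Summable fun j : ℕ => ‖b j‖ * ρ ^ j) :
    (∀ k : ℕ, k ≤ m → Summable fun l : ℕ =>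
      ‖(2 : ℂ) ^ (2 * m + l + 1) *
          (∑ j ∈ Finset.range (l + 1), b j * starRingEnd ℂ (b (l - j))) /
        ((l : ℂ) + (m : ℂ) + (k : ℂ) + 1)‖) ∧
    ((∫ η in (-1 : ℝ)..1,
        (1 - η ^ 2) ^ m * ‖∑' j : ℕ, b j * (1 - (η : ℂ)) ^ j‖ ^ 2 : ℝ) : ℂ) =
      ∑ k ∈ Finset.range (m + 1),
        (-1 : ℂ) ^ k * (m.choose k : ℂ) *
          ∑' l : ℕ,
            (2 : ℂ) ^ (2 * m + l + 1) *
                (∑ j ∈ Finset.range (l + 1), b j * starRingEnd ℂ (b (l - j))) /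
              ((l : ℂ) + (m : ℂ) + (k : ℂ) + 1) := by
  set c : ℕ → ℂ := fun l => ∑ j ∈ Finset.range (l + 1), b j * starRingEnd ℂ (b (l - j)) with hc
  have key : ∀ x ∈ Set.Icc (0 : ℝ) 2, _ := fun x hx =>
    summable_norm_and_hasSum_norm_sq (b := b) (x := x)
      (summable_norm_mul_pow_of_le hb (by
        rw [Complex.norm_of_nonneg hx.1]
        exact hx.2.trans hρ.le))
  have hc2 : Summable fun l : ℕ => ‖c l * (2 : ℂ) ^ l‖ := by
    simpa using (key 2 (by simp)).1
  have hsum : ∀ k : ℕ, Summable fun l : ℕ =>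
      ‖(2 : ℂ) ^ (2 * m + l + 1) * c l / ((l : ℂ) + (m : ℂ) + (k : ℂ) + 1)‖ := by
    intro k
    refine (hc2.mul_left (2 ^ (2 * m + 1))).of_nonneg_of_le (fun l => norm_nonneg _) fun l => ?_
    have hd : (l : ℂ) + (m : ℂ) + (k : ℂ) + 1 = ((l + m + k + 1 : ℕ) : ℂ) := by push_cast; rfl
    rw [hd, norm_div, Complex.norm_natCast]
    refine (div_le_self (norm_nonneg _) (by exact_mod_cast Nat.le_add_left 1 _)).trans_eq ?_
    simp only [norm_mul, norm_pow, Complex.norm_ofNat]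
    ring
  refine ⟨fun k _ => hsum k, ?_⟩
  have hint := hasSum_integral_pow_mul_two_sub_pow m hc2 fun x hx => (key x hx).2
  simp only [integral_pow_mul_two_sub_pow_mul_pow] at hint
  have hrhs := hasSum_sum fun k (_ : k ∈ Finset.range (m + 1)) =>
    (hsum k).of_norm.hasSum.mul_left ((-1 : ℂ) ^ k * (m.choose k : ℂ))
  rw [← hint.unique hrhs, ← intervalIntegral.integral_ofReal]
  have hsub := intervalIntegral.integral_comp_sub_left (a := -1) (b := 1)
    (fun x : ℝ => (x : ℂ) ^ m * (2 - (x : ℂ)) ^ m *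
      ((‖∑' j : ℕ, b j * (x : ℂ) ^ j‖ ^ 2 : ℝ) : ℂ)) 1
  norm_num only at hsub
  rw [← hsub]
  refine intervalIntegral.integral_congr fun η _ => ?_
  push_cast
  rw [← mul_pow]
  ring
end

section
/- Let m be a natural number and c a complex number, and let b : ℂ → ℕ → ℂ be the family of coefficient functions determined by b(z,0) = 1 and, for all z ∈ ℂ and j ≥ 1, 2j(j+m)·b(z,j) = ((j−1)(j+2m) − z + c²)·b(z,j−1) − 2c²·b(z,j−2) + c²·b(z,j−3), with terms of negative index interpreted as 0. Then the functions 𝒲_1(z) := Σ_{j≥0} b(z,j) and 𝒲_0(z) := Σ_{j≥0} j·b(z,j) are well defined (the series converge absolutely for every z ∈ ℂ) and are analytic on all of ℂ. -/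
/-- A real sequence satisfying a recurrence inequality whose leading ratio tends to
`1 / 2` is bounded by `C * (3 / 4) ^ j` once it is so up to an explicit index. -/
theorem le_geometric_of_recurrence_bound {a : ℕ → ℝ} {m R D C : ℝ} {N : ℕ}
    (hm : 0 ≤ m) (hR : 0 ≤ R) (hD : 0 ≤ D) (hC : 0 ≤ C) (hN : m + 2 * R + 15 * D + 3 ≤ N)
    (hinit : ∀ j ≤ N, a j ≤ C * (3 / 4) ^ j)
    (hrec : ∀ k : ℕ, 2 * ((k : ℝ) + 3) * (k + 3 + m) * a (k + 3) ≤
      ((k + 2) * (k + 3 + 2 * m) + R + D) * a (k + 2) + 2 * D * a (k + 1) + D * a k)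
    (j : ℕ) : a j ≤ C * (3 / 4) ^ j := by
  induction j using Nat.strong_induction_on with
  | _ j ih =>
    rcases le_or_gt j N with hj | hj
    · exact hinit j hj
    have hjR : (N : ℝ) ≤ j := by exact_mod_cast hj.le
    have hj3 : 3 ≤ j := by
      have : (3 : ℝ) ≤ j := by linarith
      exact_mod_cast this
    obtain ⟨k, rfl⟩ := Nat.exists_eq_add_of_le' hj3
    push_cast at hjR
    have h2 := ih (k + 2) (by omega)
    have h1 := ih (k + 1) (by omega)
    have h0 := ih k (by omega)
    have hpos : 0 < 2 * ((k : ℝ) + 3) * (k + 3 + m) := by positivity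
    refine le_of_mul_le_mul_left ((hrec k).trans ?_) hpos
    set P : ℝ := C * (3 / 4) ^ k with hP
    have hP0 : 0 ≤ P := by positivity
    have e3 : C * (3 / 4 : ℝ) ^ (k + 3) = 27 / 64 * P := by rw [hP]; ring
    have e2 : C * (3 / 4 : ℝ) ^ (k + 2) = 9 / 16 * P := by rw [hP]; ring
    have e1 : C * (3 / 4 : ℝ) ^ (k + 1) = 3 / 4 * P := by rw [hP]; ring
    rw [e2] at h2
    rw [e1] at h1
    rw [e3]
    have hk : (0 : ℝ) ≤ k := k.cast_nonneg
    have key : ((k + 2) * (k + 3 + 2 * m) + R + D) * (9 / 16) + 2 * D * (3 / 4) + D ≤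
        2 * ((k : ℝ) + 3) * (k + 3 + m) * (27 / 64) := by
      have hx : m + 2 * R + 15 * D ≤ (k : ℝ) + 3 := by linarith
      nlinarith [mul_le_mul_of_nonneg_left hx (by positivity : (0 : ℝ) ≤ k + 3),
        mul_nonneg hk hR, mul_nonneg hk hD, mul_nonneg hk hm]
    calc _ ≤ ((k + 2) * (k + 3 + 2 * m) + R + D) * (9 / 16 * P) + 2 * D * (3 / 4 * P) + D * P := by
          gcongr
      _ = (((k + 2) * (k + 3 + 2 * m) + R + D) * (9 / 16) + 2 * D * (3 / 4) + D) * P := by ring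
      _ ≤ (2 * ((k : ℝ) + 3) * (k + 3 + m) * (27 / 64)) * P := by gcongr
      _ = _ := by ring

/-- A series of entire functions dominated by a summable sequence on every ball is entire. -/
theorem analyticOnNhd_tsum_of_ball_bound {f : ℕ → ℂ → ℂ} (hf : ∀ j, Differentiable ℂ (f j))
    (h : ∀ R : ℝ, 0 ≤ R → ∃ u : ℕ → ℝ, Summable u ∧ ∀ j z, ‖z‖ ≤ R → ‖f j z‖ ≤ u j) :
    AnalyticOnNhd ℂ (fun z => ∑' j, f j z) Set.univ := by
  refine DifferentiableOn.analyticOnNhd (fun z _ => ?_) isOpen_univ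
  obtain ⟨u, hu, hfu⟩ := h (‖z‖ + 1) (by positivity)
  have hz : z ∈ Metric.ball (0 : ℂ) (‖z‖ + 1) := by simp
  exact ((Complex.differentiableOn_tsum_of_summable_norm hu
    (fun j => (hf j).differentiableOn) Metric.isOpen_ball
    (fun j w hw => hfu j w (mem_ball_zero_iff.mp hw).le)).differentiableAt
    (Metric.isOpen_ball.mem_nhds hz)).differentiableWithinAt


/-- the functions `𝒲₁(z) = Σⱼ b(z,j)` and `𝒲₀(z) = Σⱼ j·b(z,j)` built from
the coefficient family `b(z,·)` determined by `b(z,0) = 1` and the recurrence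
`2j(j+m)·b(z,j) = ((j-1)(j+2m) - z + c²)·b(z,j-1) - 2c²·b(z,j-2) + c²·b(z,j-3)` are well
defined (the series converge absolutely for all `z`) and entire (analytic on all of `ℂ`). -/
theorem eigenvalue_functions_entire
    (m : ℕ) (c : ℂ) (b : ℂ → ℕ → ℂ)
    (hb0 : ∀ z : ℂ, b z 0 = 1)
    (hrec : ∀ z : ℂ, ∀ j : ℕ, 1 ≤ j →
      2 * (j : ℂ) * ((j : ℂ) + (m : ℂ)) * b z j =
        (((j : ℂ) - 1) * ((j : ℂ) + 2 * (m : ℂ)) - z + c ^ 2) * b z (j - 1)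
          - 2 * c ^ 2 * (if j < 2 then 0 else b z (j - 2))
          + c ^ 2 * (if j < 3 then 0 else b z (j - 3))) :
    (∀ z : ℂ, Summable fun j : ℕ => ‖b z j‖) ∧
    (∀ z : ℂ, Summable fun j : ℕ => ‖(j : ℂ) * b z j‖) ∧
    AnalyticOnNhd ℂ (fun z : ℂ => ∑' j : ℕ, b z j) Set.univ ∧
    AnalyticOnNhd ℂ (fun z : ℂ => ∑' j : ℕ, (j : ℂ) * b z j) Set.univ := by
  have hdiff : ∀ j, Differentiable ℂ (fun z => b z j) := by
    intro j
    induction j using Nat.strong_induction_on with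
    | _ j ih =>
      rcases Nat.eq_zero_or_pos j with rfl | hj
      · simp [hb0]
      have hne : 2 * (j : ℂ) * ((j : ℂ) + (m : ℂ)) ≠ 0 := by
        have h : 2 * j * (j + m) ≠ 0 := by positivity
        exact_mod_cast h
      have heq : (fun z => b z j) = fun z =>
          ((((j : ℂ) - 1) * ((j : ℂ) + 2 * (m : ℂ)) - z + c ^ 2) * b z (j - 1)
          - 2 * c ^ 2 * (if j < 2 then 0 else b z (j - 2))
          + c ^ 2 * (if j < 3 then 0 else b z (j - 3))) / (2 * (j : ℂ) * ((j : ℂ) + (m : ℂ))) := by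
        funext z
        rw [eq_div_iff hne, mul_comm, hrec z j hj]
      have d1 := ih (j - 1) (by omega)
      have d2 : Differentiable ℂ fun z => if j < 2 then 0 else b z (j - 2) := by
        split_ifs
        · fun_prop
        · exact ih (j - 2) (by omega)
      have d3 : Differentiable ℂ fun z => if j < 3 then 0 else b z (j - 3) := by
        split_ifs
        · fun_prop
        · exact ih (j - 3) (by omega)
      rw [heq]
      fun_prop
  have hbound : ∀ R : ℝ, 0 ≤ R → ∃ C : ℝ, ∀ j z, ‖z‖ ≤ R → ‖b z j‖ ≤ C * (3 / 4) ^ j := by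
    intro R hR
    obtain ⟨N, hN⟩ := exists_nat_ge ((m : ℝ) + 2 * R + 15 * ‖c‖ ^ 2 + 3)
    have hB : ∀ j, ∃ B : ℝ, ∀ z ∈ Metric.closedBall (0 : ℂ) R, ‖b z j‖ ≤ B := fun j =>
      (isCompact_closedBall (0 : ℂ) R).exists_bound_of_continuousOn (hdiff j).continuous.continuousOn
    choose B hB using hB
    have hB0 : ∀ j, 0 ≤ B j := fun j =>
      (norm_nonneg _).trans (hB j 0 (Metric.mem_closedBall_self hR))
    refine ⟨∑ i ∈ Finset.range (N + 1), B i / (3 / 4) ^ i, fun j z hz => ?_⟩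
    have hterm : ∀ i, 0 ≤ B i / (3 / 4 : ℝ) ^ i := fun i => div_nonneg (hB0 i) (by positivity)
    refine le_geometric_of_recurrence_bound (a := fun j => ‖b z j‖) (m := m) (R := R)
      (D := ‖c‖ ^ 2) m.cast_nonneg hR (by positivity) (Finset.sum_nonneg fun i _ => hterm i) hN
      (fun i hi => ?_) (fun k => ?_) j
    · rw [← div_le_iff₀ (by positivity)]
      calc ‖b z i‖ / (3 / 4) ^ i ≤ B i / (3 / 4) ^ i := by
            gcongr
            exact hB i z (mem_closedBall_zero_iff.mpr hz)
        _ ≤ _ := Finset.single_le_sum (f := fun i => B i / (3 / 4 : ℝ) ^ i)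
            (fun i _ => hterm i) (Finset.mem_range.mpr (by omega))
    · have h := hrec z (k + 3) (by omega)
      rw [if_neg (by omega), if_neg (by omega), show k + 3 - 1 = k + 2 by omega,
        show k + 3 - 2 = k + 1 by omega, Nat.add_sub_cancel] at h
      have hl : ‖2 * ((k + 3 : ℕ) : ℂ) * (((k + 3 : ℕ) : ℂ) + (m : ℂ))‖ =
          2 * ((k : ℝ) + 3) * (k + 3 + m) := by
        have e : 2 * ((k + 3 : ℕ) : ℂ) * (((k + 3 : ℕ) : ℂ) + (m : ℂ)) =
            ((2 * (k + 3) * (k + 3 + m) : ℕ) : ℂ) := by push_cast; ring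
        rw [e, Complex.norm_natCast]
        push_cast
        ring
      have hr : ‖(((k + 3 : ℕ) : ℂ) - 1) * (((k + 3 : ℕ) : ℂ) + 2 * (m : ℂ)) - z + c ^ 2‖ ≤
          ((k : ℝ) + 2) * (k + 3 + 2 * m) + R + ‖c‖ ^ 2 := by
        have e : (((k + 3 : ℕ) : ℂ) - 1) * (((k + 3 : ℕ) : ℂ) + 2 * (m : ℂ)) =
            (((k + 2) * (k + 3 + 2 * m) : ℕ) : ℂ) := by push_cast; ring
        rw [e]
        refine (norm_add_le _ _).trans ?_
        rw [norm_pow]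
        gcongr
        refine (norm_sub_le _ _).trans ?_
        rw [Complex.norm_natCast]
        push_cast
        gcongr
      rw [← hl, ← norm_mul, h]
      refine (norm_add_le _ _).trans ?_
      gcongr ?_ + ?_
      · refine (norm_sub_le _ _).trans ?_
        rw [norm_mul, norm_mul, norm_mul, norm_pow, Complex.norm_ofNat]
        gcongr
      · rw [norm_mul, norm_pow]
  have hgeom : Summable fun j : ℕ => (3 / 4 : ℝ) ^ j :=
    summable_geometric_of_lt_one (by norm_num) (by norm_num)
  have hgeom' : Summable fun j : ℕ => (j : ℝ) * (3 / 4 : ℝ) ^ j := by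
    simpa using summable_pow_mul_geometric_of_norm_lt_one 1
      (show ‖(3 / 4 : ℝ)‖ < 1 by norm_num)
  have hdom : ∀ R : ℝ, 0 ≤ R → ∃ u : ℕ → ℝ, Summable u ∧ ∀ j z, ‖z‖ ≤ R → ‖b z j‖ ≤ u j := by
    intro R hR
    obtain ⟨C, hC⟩ := hbound R hR
    exact ⟨_, hgeom.mul_left C, hC⟩
  have hdom' : ∀ R : ℝ, 0 ≤ R →
      ∃ u : ℕ → ℝ, Summable u ∧ ∀ (j : ℕ) (z : ℂ), ‖z‖ ≤ R → ‖(j : ℂ) * b z j‖ ≤ u j := by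
    intro R hR
    obtain ⟨C, hC⟩ := hbound R hR
    refine ⟨_, hgeom'.mul_left C, fun j z hz => ?_⟩
    rw [norm_mul, Complex.norm_natCast, mul_left_comm]
    exact mul_le_mul_of_nonneg_left (hC j z hz) j.cast_nonneg
  refine ⟨fun z => ?_, fun z => ?_, analyticOnNhd_tsum_of_ball_bound hdiff hdom,
    analyticOnNhd_tsum_of_ball_bound (fun j => (hdiff j).const_mul _) hdom'⟩
  · obtain ⟨u, hu, h⟩ := hdom ‖z‖ (norm_nonneg z)
    exact hu.of_nonneg_of_le (fun _ => norm_nonneg _) fun j => h j z le_rfl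
  · obtain ⟨u, hu, h⟩ := hdom' ‖z‖ (norm_nonneg z)
    exact hu.of_nonneg_of_le (fun _ => norm_nonneg _) fun j => h j z le_rfl
end
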